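/- Let ω_r be the ray {t(cos θ, sin θ) : t ∈ [0,r]} of length r > 1 emanating from the origin, where either tan θ is rational (i.e. the ray lies along {(pt,qt) : t ∈ ℝ} for some (p,q) ∈ ℤ² ∖ {0}) or tan θ is a typical number. Then there exists C > 0, depending only on a and the direction θ, such that for all r > 1, the number of points v of the translated lattice Γ_a = {(2πk₁ + a₁, 2πk₂ + a₂) : (k₁,k₂) ∈ ℤ²} with 0 < dist(v, ω_r) ≤ r^{−1/3} is at most C·r^{2/3}. -/

import Mathlib

open Real Set Filter

/-- `α` is typical with exponent `τ` and constant `δ`. -/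
def IsTypicalWith (α τ δ : ℝ) : Prop :=
  ∀ k₁ k₂ : ℤ, k₂ ≠ 0 →
    δ / (|(k₂ : ℝ)| * (Real.log (1 + |(k₂ : ℝ)|)) ^ τ) ≤ |(k₁ : ℝ) + α * (k₂ : ℝ)|

/-- `α` is typical: typical with some exponent `τ > 0` and constant `δ > 0`. -/
def IsTypical (α : ℝ) : Prop := ∃ τ > (0:ℝ), ∃ δ > (0:ℝ), IsTypicalWith α τ δ


/-- Euclidean distance between two points of `ℝ × ℝ`. -/
noncomputable def euclDist (p q : ℝ × ℝ) : ℝ :=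
  Real.sqrt ((p.1 - q.1) ^ 2 + (p.2 - q.2) ^ 2)

/-- Euclidean distance from a point `v` to the ray
`ω_r = {t(cos θ, sin θ) : t ∈ [0,r]}`. -/
noncomputable def distToRay (θ r : ℝ) (v : ℝ × ℝ) : ℝ :=
  sInf ((fun t => euclDist v (t * Real.cos θ, t * Real.sin θ)) '' Set.Icc 0 r)

/-- The point of the translated lattice `Γ_a` indexed by `k ∈ ℤ²`. -/
noncomputable def latticePt (a : ℝ × ℝ) (k : ℤ × ℤ) : ℝ × ℝ :=
  (2 * π * (k.1 : ℝ) + a.1, 2 * π * (k.2 : ℝ) + a.2)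

/-- The indices of the points of `Γ_a` at positive distance at most `r^{-1/3}` from `ω_r`. -/
def nearRay (θ r : ℝ) (a : ℝ × ℝ) : Set (ℤ × ℤ) :=
  {k : ℤ × ℤ | 0 < distToRay θ r (latticePt a k) ∧
    distToRay θ r (latticePt a k) ≤ r ^ (-(1:ℝ)/3)}

/-- The distance to the ray is attained; stated coordinatewise. -/
lemma exists_point_of_distToRay_le {θ r ε : ℝ} (hr : 0 ≤ r) {v : ℝ × ℝ}
    (h : distToRay θ r v ≤ ε) :
    ∃ t ∈ Set.Icc 0 r, (v.1 - t * cos θ) ^ 2 + (v.2 - t * sin θ) ^ 2 ≤ ε ^ 2 := by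
  have hc : ContinuousOn (fun t => euclDist v (t * cos θ, t * sin θ)) (Set.Icc 0 r) := by
    unfold euclDist
    fun_prop
  obtain ⟨t, ht, heq⟩ := isCompact_Icc.exists_sInf_image_eq ⟨0, le_refl 0, hr⟩ hc
  refine ⟨t, ht, ?_⟩
  have h2 : euclDist v (t * cos θ, t * sin θ) ≤ ε := by
    rw [← heq]
    exact h
  have h0 : 0 ≤ euclDist v (t * cos θ, t * sin θ) := Real.sqrt_nonneg _
  exact (Real.sqrt_le_left (h0.trans h2)).1 h2

lemma distToRay_nonpos_of_mem {θ r x : ℝ} (hx : x ∈ Set.Icc 0 r) :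
    distToRay θ r (x * cos θ, x * sin θ) ≤ 0 := by
  refine csInf_le ⟨0, ?_⟩ ⟨x, hx, by simp [euclDist]⟩
  rintro _ ⟨t, -, rfl⟩
  exact Real.sqrt_nonneg _

lemma nearRay_exists_point {θ r s : ℝ} {a : ℝ × ℝ} (hs : 1 < s) (hr : r = s ^ 3) {k : ℤ × ℤ}
    (hk : k ∈ nearRay θ r a) :
    ∃ t ∈ Set.Icc 0 r, |2 * π * k.1 + a.1 - t * cos θ| ≤ s⁻¹ ∧
      |2 * π * k.2 + a.2 - t * sin θ| ≤ s⁻¹ := by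
  have hs0 : 0 < s := by linarith
  have hε : r ^ (-(1:ℝ)/3) = s⁻¹ := by
    rw [hr, ← Real.rpow_natCast, ← Real.rpow_mul hs0.le, ← Real.rpow_neg_one]
    norm_num
  have hk2 := hk.2
  rw [hε] at hk2
  obtain ⟨t, ht, h⟩ := exists_point_of_distToRay_le (by rw [hr]; positivity) hk2
  simp only [latticePt] at h
  refine ⟨t, ht, abs_le_of_sq_le_sq ?_ (by positivity), abs_le_of_sq_le_sq ?_ (by positivity)⟩
  · nlinarith [sq_nonneg (2 * π * k.2 + a.2 - t * sin θ)]
  · nlinarith [sq_nonneg (2 * π * k.1 + a.1 - t * cos θ)]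

lemma abs_int_le_of_near {b t c ε r : ℝ} {z : ℤ} (ht : t ∈ Set.Icc 0 r) (hc : |c| ≤ 1)
    (hε : ε ≤ 1) (h : |2 * π * z + b - t * c| ≤ ε) : |(z : ℝ)| ≤ r + 1 + |b| := by
  have h1 : |t * c| ≤ r := by
    rw [abs_mul, abs_of_nonneg ht.1]
    nlinarith [ht.1, ht.2, abs_nonneg c]
  have h2 : |2 * π * (z : ℝ)| ≤ r + 1 + |b| := by
    rw [abs_le] at h h1 ⊢
    constructor <;> linarith [le_abs_self b, neg_abs_le b]
  rw [abs_mul, abs_of_pos (by positivity)] at h2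
  nlinarith [Real.pi_gt_three, abs_nonneg (z : ℝ)]

/-- The integer points of the square of half-side `X`. -/
def intBox (X : ℝ) : Set (ℤ × ℤ) := {k | |(k.1 : ℝ)| ≤ X ∧ |(k.2 : ℝ)| ≤ X}

lemma intBox_finite (X : ℝ) : (intBox X).Finite := by
  refine ((Set.finite_Icc (-⌈X⌉) ⌈X⌉).prod (Set.finite_Icc (-⌈X⌉) ⌈X⌉)).subset ?_
  rintro ⟨x, y⟩ ⟨hx, hy⟩
  have hX := Int.le_ceil X
  rw [abs_le] at hx hy
  simp only [Set.mem_prod, Set.mem_Icc]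
  refine ⟨⟨?_, ?_⟩, ?_, ?_⟩ <;> (rify; linarith)

lemma intBox_mono {X Y : ℝ} (h : X ≤ Y) : intBox X ⊆ intBox Y :=
  fun _ hk => ⟨hk.1.trans h, hk.2.trans h⟩

lemma nearRay_subset_intBox {θ r s : ℝ} {a : ℝ × ℝ} (hs : 1 < s) (hr : r = s ^ 3) :
    nearRay θ r a ⊆ intBox (r + 1 + |a.1| + |a.2|) := by
  intro k hk
  obtain ⟨t, ht, h1, h2⟩ := nearRay_exists_point hs hr hk
  have hε : s⁻¹ ≤ 1 := inv_le_one_of_one_le₀ hs.le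
  have e1 := abs_int_le_of_near ht (abs_cos_le_one θ) hε h1
  have e2 := abs_int_le_of_near ht (abs_sin_le_one θ) hε h2
  constructor <;> linarith [abs_nonneg a.1, abs_nonneg a.2]

/-- Elements of `2πℤ` in a window of length `2` coincide. -/
lemma int_eq_of_abs_lt {x y : ℤ} (h : |2 * π * x - 2 * π * y| < 2) : x = y := by
  rw [← mul_sub, abs_mul, abs_of_pos (by positivity)] at h
  have : |(x : ℝ) - y| < 1 := by nlinarith [Real.pi_gt_three, abs_nonneg ((x : ℝ) - y)]
  have h2 : |x - y| < 1 := by exact_mod_cast this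
  exact sub_eq_zero.1 (Int.abs_lt_one_iff.1 h2)

/-- A coset of `2πℤ` has no nonzero elements too close to `0`. -/
lemma exists_pos_le_abs_coset (b : ℝ) :
    ∃ d > (0:ℝ), ∀ z : ℤ, 2 * π * z + b ≠ 0 → d ≤ |2 * π * z + b| := by
  by_cases h : ∃ z : ℤ, 2 * π * z + b ≠ 0 ∧ |2 * π * z + b| < 1
  · obtain ⟨z, hz, hz1⟩ := h
    refine ⟨_, abs_pos.2 hz, fun y hy => ?_⟩
    by_contra! hlt
    have : y = z := by
      apply int_eq_of_abs_lt
      rw [abs_lt] at hz1 ⊢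
      have := abs_lt.1 (hlt.trans (abs_lt.2 hz1))
      constructor <;> linarith
    rw [this] at hlt
    exact lt_irrefl _ hlt
  · push Not at h
    exact ⟨1, one_pos, h⟩

/-- A lattice point near the ray and on its line lies just beyond one of the two endpoints. -/
lemma exists_coord_of_collinear {θ r s : ℝ} {a : ℝ × ℝ} (hs : 1 < s) (hr : r = s ^ 3) {k : ℤ × ℤ}
    (hk : k ∈ nearRay θ r a)
    (hline : (2 * π * k.1 + a.1) * sin θ = (2 * π * k.2 + a.2) * cos θ) :
    ∃ x : ℝ, 2 * π * k.1 + a.1 = x * cos θ ∧ 2 * π * k.2 + a.2 = x * sin θ ∧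
      (x ∈ Set.Icc (-1) 0 ∨ x ∈ Set.Icc r (r + 1)) := by
  have hcs := sin_sq_add_cos_sq θ
  set v := 2 * π * k.1 + a.1 with hv
  set w := 2 * π * k.2 + a.2 with hw
  obtain ⟨x, hx⟩ : ∃ x, x = v * cos θ + w * sin θ := ⟨_, rfl⟩
  have e1 : v = x * cos θ := by
    rw [hx]; linear_combination (-v) * hcs + sin θ * hline
  have e2 : w = x * sin θ := by
    rw [hx]; linear_combination (-w) * hcs - cos θ * hline
  have hx0 : ¬ x ∈ Set.Icc 0 r := by
    intro hmem
    have := distToRay_nonpos_of_mem (θ := θ) hmem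
    rw [← e1, ← e2] at this
    exact absurd hk.1 (not_lt.2 this)
  have hk2 : distToRay θ r (latticePt a k) ≤ 1 :=
    hk.2.trans (Real.rpow_le_one_of_one_le_of_nonpos (hr ▸ one_le_pow₀ hs.le) (by norm_num))
  obtain ⟨t, ht, h⟩ := exists_point_of_distToRay_le (by rw [hr]; positivity) hk2
  have h' : (v - t * cos θ) ^ 2 + (w - t * sin θ) ^ 2 ≤ 1 ^ 2 := h
  have hxt : |x - t| ≤ 1 := by
    apply abs_le_of_sq_le_sq _ zero_le_one
    rw [e1, e2] at h'
    calc (x - t) ^ 2 = (x * cos θ - t * cos θ) ^ 2 + (x * sin θ - t * sin θ) ^ 2 := by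
          linear_combination (-(x - t) ^ 2) * hcs
      _ ≤ 1 ^ 2 := h'
  rw [abs_le] at hxt
  refine ⟨x, e1, e2, ?_⟩
  rcases lt_or_ge x 0 with hneg | hpos
  · exact Or.inl ⟨by linarith [ht.1], hneg.le⟩
  · have : r < x := by
      by_contra! hle
      exact hx0 ⟨hpos, hle⟩
    exact Or.inr ⟨this.le, by linarith [ht.2]⟩

/-- At most one lattice point lies on a given unit segment of a line through the origin. -/
lemma subsingleton_of_unit_segment (θ b : ℝ) (a : ℝ × ℝ) {S : Set (ℤ × ℤ)}
    (hS : ∀ k ∈ S, ∃ x : ℝ, 2 * π * k.1 + a.1 = x * cos θ ∧ 2 * π * k.2 + a.2 = x * sin θ ∧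
      x ∈ Set.Icc b (b + 1)) : S.Subsingleton := by
  intro k hk l hl
  obtain ⟨x, hx1, hx2, hx⟩ := hS k hk
  obtain ⟨y, hy1, hy2, hy⟩ := hS l hl
  have hxy : |x - y| ≤ 1 := by
    rw [abs_le]
    constructor <;> linarith [hx.1, hx.2, hy.1, hy.2]
  have key : ∀ c : ℝ, |c| ≤ 1 → |x * c - y * c| < 2 := by
    intro c hc
    rw [← sub_mul, abs_mul]
    nlinarith [abs_nonneg (x - y), abs_nonneg c]
  refine Prod.ext (int_eq_of_abs_lt ?_) (int_eq_of_abs_lt ?_)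
  · convert key _ (abs_cos_le_one θ) using 2
    linarith
  · convert key _ (abs_sin_le_one θ) using 2
    linarith

lemma exists_ncard_nearRay_le_of_rational {θ : ℝ} (a : ℝ × ℝ) {p q : ℤ} (hpq : ¬(p = 0 ∧ q = 0))
    (hdir : sin θ * p = cos θ * q) :
    ∃ C > (0:ℝ), ∀ s : ℝ, 1 < s → ((nearRay θ (s ^ 3) a).ncard : ℝ) ≤ C * s ^ 2 := by
  obtain ⟨d, hd, hcoset⟩ := exists_pos_le_abs_coset (p * a.2 - q * a.1)
  obtain ⟨T, hT⟩ : ∃ T : ℝ, T = (|(p : ℝ)| + |(q : ℝ)|) / d := ⟨_, rfl⟩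
  have hB := intBox_finite (T ^ 3 + 1 + |a.1| + |a.2|)
  refine ⟨(intBox (T ^ 3 + 1 + |a.1| + |a.2|)).ncard + 2, by positivity, fun s hs => ?_⟩
  suffices h : ((nearRay θ (s ^ 3) a).ncard : ℝ) ≤
      (intBox (T ^ 3 + 1 + |a.1| + |a.2|)).ncard + 2 by
    refine h.trans (le_mul_of_one_le_right (by positivity) (one_le_pow₀ hs.le))
  have hs0 : 0 < s := by linarith
  rcases le_or_gt s T with hsT | hsT
  · have hsub : nearRay θ (s ^ 3) a ⊆ intBox (T ^ 3 + 1 + |a.1| + |a.2|) :=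
      (nearRay_subset_intBox hs rfl).trans (intBox_mono (by gcongr))
    have : ((nearRay θ (s ^ 3) a).ncard : ℝ) ≤ (intBox (T ^ 3 + 1 + |a.1| + |a.2|)).ncard := by
      exact_mod_cast Set.ncard_le_ncard hsub hB
    linarith
  · have hline : ∀ k ∈ nearRay θ (s ^ 3) a,
        (2 * π * k.1 + a.1) * sin θ = (2 * π * k.2 + a.2) * cos θ := by
      intro k hk
      obtain ⟨t, ht, h1, h2⟩ := nearRay_exists_point hs rfl hk
      have hw : 2 * π * ((p * k.2 - q * k.1 : ℤ) : ℝ) + (p * a.2 - q * a.1) = 0 := by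
        by_contra hne
        have hle := hcoset _ hne
        have heq : 2 * π * ((p * k.2 - q * k.1 : ℤ) : ℝ) + (p * a.2 - q * a.1) =
            p * (2 * π * k.2 + a.2 - t * sin θ) - q * (2 * π * k.1 + a.1 - t * cos θ) := by
          push_cast
          linear_combination t * hdir
        rw [heq] at hle
        have hup : |p * (2 * π * k.2 + a.2 - t * sin θ) - q * (2 * π * k.1 + a.1 - t * cos θ)| ≤
            (|(p : ℝ)| + |(q : ℝ)|) * s⁻¹ := by
          refine (abs_sub _ _).trans ?_
          rw [abs_mul, abs_mul, add_mul]
          gcongr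
        have hlt : (|(p : ℝ)| + |(q : ℝ)|) * s⁻¹ < d := by
          rw [hT, div_lt_iff₀ hd] at hsT
          rw [← div_eq_mul_inv, div_lt_iff₀ hs0]
          linarith
        linarith
      push_cast at hw
      by_cases hp : p = 0
      · have hq : (q : ℝ) ≠ 0 := by exact_mod_cast fun hq => hpq ⟨hp, hq⟩
        apply mul_left_cancel₀ hq
        linear_combination (-sin θ) * hw + (2 * π * k.2 + a.2) * hdir
      · have hp' : (p : ℝ) ≠ 0 := by exact_mod_cast hp
        apply mul_left_cancel₀ hp'
        linear_combination (-cos θ) * hw + (2 * π * k.1 + a.1) * hdir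
    have hcov : nearRay θ (s ^ 3) a ⊆
        {k | ∃ x : ℝ, 2 * π * k.1 + a.1 = x * cos θ ∧ 2 * π * k.2 + a.2 = x * sin θ ∧
          x ∈ Set.Icc (-1) (-1 + 1)} ∪
        {k | ∃ x : ℝ, 2 * π * k.1 + a.1 = x * cos θ ∧ 2 * π * k.2 + a.2 = x * sin θ ∧
          x ∈ Set.Icc (s ^ 3) (s ^ 3 + 1)} := by
      intro k hk
      obtain ⟨x, hx1, hx2, hx | hx⟩ := exists_coord_of_collinear hs rfl hk (hline k hk)
      · exact Or.inl ⟨x, hx1, hx2, by simpa using hx⟩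
      · exact Or.inr ⟨x, hx1, hx2, hx⟩
    have hA := subsingleton_of_unit_segment θ (-1) a (fun k hk => hk)
    have hC := subsingleton_of_unit_segment θ (s ^ 3) a (fun k hk => hk)
    have h1 := Set.ncard_le_ncard hcov (hA.finite.union hC.finite)
    have h2 := h1.trans (Set.ncard_union_le _ _)
    have h3 := h2.trans (add_le_add ((Set.ncard_le_one hA.finite).2 fun _ h _ h' => hA h h')
      ((Set.ncard_le_one hC.finite).2 fun _ h _ h' => hC h h'))
    have h4 : ((nearRay θ (s ^ 3) a).ncard : ℝ) ≤ 2 := by exact_mod_cast h3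
    linarith [Nat.cast_nonneg (α := ℝ) (intBox (T ^ 3 + 1 + |a.1| + |a.2|)).ncard]

lemma IsTypical.exists_div_sq_le {α : ℝ} (h : IsTypical α) :
    ∃ δ > (0:ℝ), ∀ k₁ k₂ : ℤ, k₂ ≠ 0 → δ / (k₂ : ℝ) ^ 2 ≤ |(k₁ : ℝ) + α * k₂| := by
  obtain ⟨τ, hτ, δ, hδ, h⟩ := h
  refine ⟨δ / (2 * τ ^ τ), by positivity, fun k₁ k₂ hk => le_trans ?_ (h k₁ k₂ hk)⟩
  have hx : 1 ≤ |(k₂ : ℝ)| := by exact_mod_cast Int.one_le_abs hk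
  rw [← sq_abs (k₂ : ℝ)]
  generalize |(k₂ : ℝ)| = x at hx
  have hlog : 0 < Real.log (1 + x) := Real.log_pos (by linarith)
  have h1 : Real.log (1 + x) ≤ τ * (1 + x) ^ (1 / τ) := by
    have := Real.log_le_rpow_div (x := 1 + x) (ε := 1 / τ) (by linarith) (by positivity)
    rwa [div_div_eq_mul_div, div_one, mul_comm] at this
  have h2 : Real.log (1 + x) ^ τ ≤ τ ^ τ * (1 + x) := by
    calc Real.log (1 + x) ^ τ ≤ (τ * (1 + x) ^ (1 / τ)) ^ τ := by gcongr
      _ = τ ^ τ * (1 + x) := by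
        rw [Real.mul_rpow hτ.le (by positivity), ← Real.rpow_mul (by linarith),
          one_div_mul_cancel hτ.ne', Real.rpow_one]
  rw [div_div]
  have hττ : 0 < τ ^ τ := by positivity
  refine div_le_div_of_nonneg_left hδ.le (by positivity) ?_
  calc x * Real.log (1 + x) ^ τ ≤ x * (τ ^ τ * (1 + x)) := by gcongr
    _ ≤ x * (τ ^ τ * (2 * x)) := by gcongr; linarith
    _ = 2 * τ ^ τ * x ^ 2 := by ring

lemma card_le_of_abs_sub_le {S : Finset ℤ} {A B : ℝ} (hB : 0 ≤ B)
    (hS : ∀ z ∈ S, |(z : ℝ) - A| ≤ B) : (S.card : ℝ) ≤ 2 * B + 1 := by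
  have hsub : S ⊆ Finset.Icc ⌈A - B⌉ ⌊A + B⌋ := by
    intro z hz
    have := abs_le.1 (hS z hz)
    rw [Finset.mem_Icc, Int.ceil_le, Int.le_floor]
    constructor <;> linarith
  have h1 := Finset.card_le_card hsub
  rw [Int.card_Icc] at h1
  have h2 : ((⌊A + B⌋ + 1 - ⌈A - B⌉).toNat : ℝ) ≤ 2 * B + 1 := by
    rcases le_total (⌊A + B⌋ + 1 - ⌈A - B⌉) 0 with h | h
    · rw [Int.toNat_of_nonpos h]
      push_cast
      linarith
    · have : ((⌊A + B⌋ + 1 - ⌈A - B⌉).toNat : ℝ) = ((⌊A + B⌋ + 1 - ⌈A - B⌉ : ℤ) : ℝ) := by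
        exact_mod_cast Int.toNat_of_nonneg h
      rw [this]
      push_cast
      linarith [Int.floor_le (A + B), Int.le_ceil (A - B)]
  exact le_trans (by exact_mod_cast h1) h2

/-- Integer points in a strip of slope `α` above an interval of length `m.den`, where `m` is
a good rational approximation of `α`. -/
lemma card_strip_block_le {α β η : ℝ} (hη : 0 ≤ η) {m : ℚ} (hm : |α - m| ≤ 1 / (m.den : ℝ) ^ 2)
    (j : ℤ) {S : Finset (ℤ × ℤ)}
    (hS : ∀ k ∈ S, j ≤ k.1 ∧ k.1 < j + m.den ∧ |(k.2 : ℝ) - α * k.1 - β| ≤ η) :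
    (S.card : ℝ) ≤ 2 * (η * m.den) + 3 := by
  classical
  have hq : (0 : ℝ) < m.den := by exact_mod_cast m.den_pos
  have hmq : (m : ℝ) * m.den = m.num := by exact_mod_cast Rat.mul_den_eq_num m
  let f : ℤ × ℤ → ℤ := fun k => m.den * k.2 - m.num * (k.1 - j)
  have hinj : Set.InjOn f S := by
    intro k hk l hl hkl
    obtain ⟨hk1, hk2, -⟩ := hS k hk
    obtain ⟨hl1, hl2, -⟩ := hS l hl
    have hkl' : (m.den : ℤ) * (k.2 - l.2) = m.num * (k.1 - l.1) := by
      simp only [f] at hkl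
      linarith
    have hcop : IsCoprime (m.den : ℤ) m.num := by
      rw [Int.isCoprime_iff_gcd_eq_one, Int.gcd_comm]
      exact m.reduced
    have hdvd : (m.den : ℤ) ∣ k.1 - l.1 := hcop.dvd_of_dvd_mul_left ⟨_, hkl'.symm⟩
    have h0 : k.1 - l.1 = 0 :=
      Int.eq_zero_of_abs_lt_dvd hdvd (abs_lt.2 ⟨by linarith, by linarith⟩)
    rw [h0, mul_zero, mul_eq_zero] at hkl'
    have h1 : k.2 - l.2 = 0 := hkl'.resolve_left (by exact_mod_cast m.den_pos.ne')
    exact Prod.ext (sub_eq_zero.1 h0) (sub_eq_zero.1 h1)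
  rw [← Finset.card_image_of_injOn hinj]
  have key := card_le_of_abs_sub_le (S := S.image f) (A := m.den * (α * j + β))
    (B := η * m.den + 1) (by positivity) ?_
  · linarith
  intro z hz
  obtain ⟨k, hk, rfl⟩ := Finset.mem_image.1 hz
  obtain ⟨hk1, hk2, hk3⟩ := hS k hk
  have e : ((f k : ℤ) : ℝ) - m.den * (α * j + β) =
      m.den * (k.2 - α * k.1 - β) + (α - m) * (m.den * (k.1 - j)) := by
    simp only [f]
    push_cast
    linear_combination ((k.1 : ℝ) - j) * hmq
  rw [e]
  refine (abs_add_le _ _).trans ?_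
  have hi0 : (0 : ℝ) ≤ (k.1 : ℝ) - j := by rify at hk1; linarith
  have hi1 : (k.1 : ℝ) - j ≤ m.den := by
    have : (k.1 : ℝ) < j + m.den := by exact_mod_cast hk2
    linarith
  refine add_le_add ?_ ?_
  · rw [abs_mul, abs_of_pos hq, mul_comm]
    gcongr
  · rw [abs_mul, abs_of_nonneg (mul_nonneg hq.le hi0)]
    calc |α - m| * (m.den * (k.1 - j)) ≤ 1 / (m.den : ℝ) ^ 2 * (m.den * m.den) := by gcongr
      _ = 1 := by field_simp

lemma card_strip_le {α β η X : ℝ} (hη : 0 ≤ η) (hX : 0 ≤ X) {m : ℚ}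
    (hm : |α - m| ≤ 1 / (m.den : ℝ) ^ 2) {S : Finset (ℤ × ℤ)}
    (hS : ∀ k ∈ S, |(k.1 : ℝ)| ≤ X ∧ |(k.2 : ℝ) - α * k.1 - β| ≤ η) :
    (S.card : ℝ) ≤ (2 * (η * m.den) + 3) * (2 * (X / m.den + 1) + 1) := by
  classical
  have hq : (0 : ℝ) < m.den := by exact_mod_cast m.den_pos
  have hqz : (0 : ℤ) < m.den := by exact_mod_cast m.den_pos
  let g : ℤ × ℤ → ℤ := fun k => k.1 / m.den
  have hfib : ∀ b ∈ S.image g, (S.filter (fun k => g k = b)).card ≤ ⌊2 * (η * m.den) + 3⌋₊ := by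
    intro b _
    apply Nat.le_floor
    refine card_strip_block_le (β := β) hη hm (m.den * b) ?_
    intro k hk
    obtain ⟨hkS, rfl⟩ := Finset.mem_filter.1 hk
    refine ⟨Int.mul_ediv_self_le hqz.ne', ?_, (hS k hkS).2⟩
    exact Int.lt_mul_ediv_self_add hqz
  have h1 := Finset.card_le_mul_card_image S _ hfib
  have h2 : ((S.image g).card : ℝ) ≤ 2 * (X / m.den + 1) + 1 := by
    refine card_le_of_abs_sub_le (A := 0) (by positivity) ?_
    intro z hz
    obtain ⟨k, hk, rfl⟩ := Finset.mem_image.1 hz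
    have hk1 := abs_le.1 (hS k hk).1
    have e1 : (m.den : ℝ) * (g k : ℤ) ≤ k.1 := by
      exact_mod_cast Int.mul_ediv_self_le (x := k.1) hqz.ne'
    have e2 : (k.1 : ℝ) < m.den * (g k : ℤ) + m.den := by
      exact_mod_cast Int.lt_mul_ediv_self_add (x := k.1) hqz
    have e3 : (m.den : ℝ) * (X / m.den) = X := by field_simp
    rw [sub_zero, abs_le]
    constructor
    · by_contra! hlt
      nlinarith
    · by_contra! hlt
      nlinarith
  have h3 : (S.card : ℝ) ≤ ⌊2 * (η * m.den) + 3⌋₊ * (S.image g).card := by exact_mod_cast h1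
  refine h3.trans (mul_le_mul (Nat.floor_le (by positivity)) h2 (by positivity) (by positivity))

lemma exists_ncard_nearRay_le_of_typical {θ : ℝ} (a : ℝ × ℝ) (hcos : cos θ ≠ 0)
    (hα : IsTypical (tan θ)) :
    ∃ C > (0:ℝ), ∀ s : ℝ, 1 < s → ((nearRay θ (s ^ 3) a).ncard : ℝ) ≤ C * s ^ 2 := by
  obtain ⟨δ, hδ, hdio⟩ := hα.exists_div_sq_le
  set α := tan θ with hαdef
  obtain ⟨K, hK⟩ : ∃ K : ℝ, K = 2 + |a.1| := ⟨_, rfl⟩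
  obtain ⟨A, hA⟩ : ∃ A : ℝ, A = 1 + |α| := ⟨_, rfl⟩
  have hA0 : 0 < A := by rw [hA]; positivity
  have hK0 : 0 < K := by rw [hK]; positivity
  have hδ' : 0 < √δ := Real.sqrt_pos.2 hδ
  refine ⟨4 * A * K + 6 * A + 6 * K / √δ + 9, by positivity, fun s hs => ?_⟩
  have hs0 : 0 < s := by linarith
  have hs2 : 1 ≤ s ^ 2 := one_le_pow₀ hs.le
  have hs3 : 1 ≤ s ^ 3 := one_le_pow₀ hs.le
  have hfin : (nearRay θ (s ^ 3) a).Finite :=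
    (intBox_finite _).subset (nearRay_subset_intBox hs rfl)
  have hn : 0 < ⌊s ^ 3⌋₊ := Nat.floor_pos.2 hs3
  obtain ⟨m, hm, hden⟩ := Real.exists_rat_abs_sub_le_and_den_le α hn
  have hn1 : s ^ 3 < (⌊s ^ 3⌋₊ : ℝ) + 1 := Nat.lt_floor_add_one _
  have hq : (0 : ℝ) < m.den := by exact_mod_cast m.den_pos
  have hqs : (m.den : ℝ) ≤ s ^ 3 :=
    (Nat.cast_le.2 hden).trans (Nat.floor_le (by positivity))
  have hm2 : |α - m| ≤ 1 / (m.den : ℝ) ^ 2 := by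
    refine hm.trans ?_
    rw [sq]
    gcongr
    linarith
  have hqlow : √δ * s ≤ m.den := by
    have h1 := hdio (-m.num) m.den (by exact_mod_cast m.den_pos.ne')
    have hmq : (m : ℝ) * m.den = m.num := by exact_mod_cast Rat.mul_den_eq_num m
    have h2 : ((-m.num : ℤ) : ℝ) + α * ((m.den : ℤ) : ℝ) = (α - m) * m.den := by
      push_cast
      linear_combination hmq
    rw [h2, abs_mul, abs_of_pos hq] at h1
    have h3 : δ / (m.den : ℝ) ^ 2 ≤ 1 / (⌊s ^ 3⌋₊ + 1) := by
      refine le_trans (by exact_mod_cast h1) ((mul_le_mul_of_nonneg_right hm hq.le).trans_eq ?_)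
      field_simp
    rw [div_le_div_iff₀ (by positivity) (by positivity), one_mul] at h3
    refine (sq_le_sq₀ (by positivity) hq.le).1 ?_
    rw [mul_pow, Real.sq_sqrt hδ.le]
    calc δ * s ^ 2 ≤ δ * (⌊s ^ 3⌋₊ + 1) := by
          gcongr
          nlinarith
      _ ≤ _ := h3
  have hS : ∀ k ∈ hfin.toFinset, |(k.1 : ℝ)| ≤ K * s ^ 3 ∧
      |(k.2 : ℝ) - α * k.1 - (α * a.1 - a.2) / (2 * π)| ≤ A * s⁻¹ := by
    intro k hk
    obtain ⟨t, ht, h1, h2⟩ := nearRay_exists_point hs rfl (hfin.mem_toFinset.1 hk)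
    have hε : s⁻¹ ≤ 1 := inv_le_one_of_one_le₀ hs.le
    constructor
    · have := abs_int_le_of_near ht (abs_cos_le_one θ) hε h1
      rw [hK]
      nlinarith [abs_nonneg a.1]
    · have htan : α * cos θ = sin θ := tan_mul_cos hcos
      have heq : 2 * π * (k.2 - α * k.1 - (α * a.1 - a.2) / (2 * π)) =
          (2 * π * k.2 + a.2 - t * sin θ) - α * (2 * π * k.1 + a.1 - t * cos θ) := by
        field_simp
        linear_combination (-t) * htan
      have hup : |2 * π * (k.2 - α * k.1 - (α * a.1 - a.2) / (2 * π))| ≤ A * s⁻¹ := by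
        rw [heq, hA, add_mul, one_mul]
        refine (abs_sub _ _).trans (add_le_add h2 ?_)
        rw [abs_mul]
        gcongr
      rw [abs_mul, abs_of_pos (by positivity)] at hup
      refine le_trans (le_mul_of_one_le_left (abs_nonneg _) ?_) hup
      linarith [Real.pi_gt_three]
  have hcard := card_strip_le (by positivity) (by positivity) hm2 hS
  rw [Set.ncard_eq_toFinset_card _ hfin]
  refine hcard.trans ?_
  have e1 : A * s⁻¹ * m.den ≤ A * s ^ 2 := by
    calc A * s⁻¹ * m.den ≤ A * s⁻¹ * s ^ 3 := by gcongr
      _ = A * s ^ 2 := by field_simp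
  have e2 : K * s ^ 3 / m.den ≤ K / √δ * s ^ 2 := by
    calc K * s ^ 3 / m.den ≤ K * s ^ 3 / (√δ * s) := by gcongr
      _ = K / √δ * s ^ 2 := by field_simp
  have e3 : A * s⁻¹ * m.den * (K * s ^ 3 / m.den) = A * K * s ^ 2 := by field_simp
  calc (2 * (A * s⁻¹ * m.den) + 3) * (2 * (K * s ^ 3 / m.den + 1) + 1)
      = 4 * (A * s⁻¹ * m.den * (K * s ^ 3 / m.den)) + 6 * (A * s⁻¹ * m.den)
        + 6 * (K * s ^ 3 / m.den) + 9 := by ring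
    _ ≤ 4 * (A * K * s ^ 2) + 6 * (A * s ^ 2) + 6 * (K / √δ * s ^ 2) + 9 * s ^ 2 := by
      rw [e3]
      linarith
    _ = (4 * A * K + 6 * A + 6 * K / √δ + 9) * s ^ 2 := by ring

/-- **Lattice points near a ray with rational or typical slope.** Let `ω_r` be the ray
of length `r > 1` from the origin in direction `θ`, where either the ray lies along a
rational line `{(pt,qt) : t ∈ ℝ}` with `(p,q) ∈ ℤ² ∖ {0}`, or `tan θ` is typical.
Then there is `C > 0`, depending only on `a` and `θ`, such that for all `r > 1`, the
set of points `v ∈ Γ_a` with `0 < dist(v, ω_r) ≤ r^{-1/3}` is finite of cardinality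
at most `C r^{2/3}`. -/
theorem lattice_points_near_ray (θ : ℝ) (a : ℝ × ℝ)
    (hdir : (∃ p q : ℤ, ¬(p = 0 ∧ q = 0) ∧
        Real.sin θ * (p : ℝ) = Real.cos θ * (q : ℝ)) ∨
      (Real.cos θ ≠ 0 ∧ IsTypical (Real.tan θ))) :
    ∃ C > (0:ℝ), ∀ r : ℝ, 1 < r →
      {k : ℤ × ℤ | 0 < distToRay θ r (latticePt a k) ∧
          distToRay θ r (latticePt a k) ≤ r ^ (-(1:ℝ)/3)}.Finite ∧
      (({k : ℤ × ℤ | 0 < distToRay θ r (latticePt a k) ∧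
          distToRay θ r (latticePt a k) ≤ r ^ (-(1:ℝ)/3)}.ncard : ℝ))
        ≤ C * r ^ ((2:ℝ)/3) := by
  obtain ⟨C, hC, hbound⟩ :
      ∃ C > (0:ℝ), ∀ s : ℝ, 1 < s → ((nearRay θ (s ^ 3) a).ncard : ℝ) ≤ C * s ^ 2 := by
    rcases hdir with ⟨p, q, hpq, hdir⟩ | ⟨hcos, hα⟩
    · exact exists_ncard_nearRay_le_of_rational a hpq hdir
    · exact exists_ncard_nearRay_le_of_typical a hcos hα
  refine ⟨C, hC, fun r hr => ?_⟩
  have hr0 : 0 ≤ r := by linarith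
  have hs : 1 < r ^ ((1:ℝ)/3) := Real.one_lt_rpow hr (by norm_num)
  have hr3 : r = (r ^ ((1:ℝ)/3)) ^ 3 := by
    rw [← Real.rpow_natCast, ← Real.rpow_mul hr0]
    norm_num
  have hr2 : r ^ ((2:ℝ)/3) = (r ^ ((1:ℝ)/3)) ^ 2 := by
    rw [← Real.rpow_natCast, ← Real.rpow_mul hr0]
    norm_num
  refine ⟨(intBox_finite _).subset (nearRay_subset_intBox hs hr3), ?_⟩
  have h := hbound _ hs
  rw [← hr3, ← hr2] at h
  exact h
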